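/- Let A be a real unital Banach algebra, a : [0,1] → A continuous, and s ∈ [0,1]. For 0 ≤ b ≤ c ≤ 1 and n ≥ 1 write J_n(c,b) := ∫_{c ≥ t_1 ≥ … ≥ t_n ≥ b} a(t_1)·…·a(t_n) dt_1⋯dt_n (Bochner integral over {t ∈ ℝ^n : c ≥ t_1 ≥ … ≥ t_n ≥ b} with respect to Lebesgue measure), and J_0(c,b) := 1 (the unit of A). Then for every n ≥ 1: J_n(1,0) = Σ_{l=0}^{n} J_l(1,s) · J_{n−l}(s,0). (This factorization of iterated integrals under subdivision of the interval is the analytic content of the factorization property of Chen's map under concatenation of paths.) -/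

import Mathlib

noncomputable section
open MeasureTheory Set

/-- The ordered set `{t ∈ ℝ^n : c ≥ t_1 ≥ … ≥ t_n ≥ b}`. -/
def ordSet (n : ℕ) (b c : ℝ) : Set (Fin n → ℝ) :=
  {t | (∀ i, b ≤ t i ∧ t i ≤ c) ∧ ∀ i j : Fin n, i ≤ j → t j ≤ t i}

/-- The iterated integral `J_n(c,b) = ∫_{c ≥ t_1 ≥ … ≥ t_n ≥ b} a(t_1)·…·a(t_n) dt`
(Bochner integral, ordered product), with `J_0(c,b) := 1`. -/
def iterInt {A : Type*} [NormedRing A] [NormedAlgebra ℝ A] [CompleteSpace A]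
    (a : ℝ → A) : ℕ → ℝ → ℝ → A
  | 0, _, _ => 1
  | (n + 1), c, b => ∫ t in ordSet (n + 1) b c, (List.ofFn fun i : Fin (n + 1) => a (t i)).prod

theorem ordSet_cons (n : ℕ) (b c x : ℝ) (y : Fin n → ℝ) :
    (Fin.cons x y : Fin (n+1) → ℝ) ∈ ordSet (n+1) b c ↔ x ∈ Icc b c ∧ y ∈ ordSet n b x := by
  simp only [ordSet, mem_ofPred_eq, Fin.forall_fin_succ, Fin.cons_zero, Fin.cons_succ, mem_Icc]
  constructor
  · rintro ⟨⟨h0, h1⟩, h2, h3⟩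
    exact ⟨h0, fun i => ⟨(h1 i).1, h2.2 i (Fin.zero_le _)⟩,
      fun i j hij => (h3 i).2 j (Fin.succ_le_succ_iff.2 hij)⟩
  · rintro ⟨h0, h1, h2⟩
    refine ⟨⟨h0, fun i => ⟨(h1 i).1, (h1 i).2.trans h0.2⟩⟩, ⟨fun _ => le_rfl, fun j _ => (h1 j).2⟩,
      fun i => ⟨fun h => ?_, fun j h => h2 i j (Fin.succ_le_succ_iff.1 h)⟩⟩
    exact absurd h (by simp)

theorem isCompact_ordSet (n : ℕ) (b c : ℝ) : IsCompact (ordSet n b c) := by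
  have h1 : IsCompact (Set.pi univ (fun _ : Fin n => Icc b c)) :=
    isCompact_univ_pi fun _ => isCompact_Icc
  refine h1.of_isClosed_subset ?_ (fun t ht i _ => ht.1 i)
  have : ordSet n b c = (⋂ i, {t | b ≤ t i} ∩ {t | t i ≤ c}) ∩
      ⋂ (i : Fin n), ⋂ (j : Fin n), ⋂ (_ : i ≤ j), {t | t j ≤ t i} := by
    ext t; simp [ordSet]
  rw [this]
  refine IsClosed.inter (isClosed_iInter fun i => IsClosed.inter ?_ ?_)
    (isClosed_iInter fun i => isClosed_iInter fun j => isClosed_iInter fun _ => ?_)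
  · exact isClosed_le continuous_const (continuous_apply i)
  · exact isClosed_le (continuous_apply i) continuous_const
  · exact isClosed_le (continuous_apply j) (continuous_apply i)

section
variable {A : Type*} [NormedRing A] [NormedAlgebra ℝ A] [CompleteSpace A]

theorem iterInt_eq (a : ℝ → A) (n : ℕ) (c b : ℝ) :
    iterInt a n c b = ∫ t in ordSet n b c, (List.ofFn fun i : Fin n => a (t i)).prod := by
  cases n with
  | succ n => rfl
  | zero =>
    have : ordSet 0 b c = univ := by ext t; simp [ordSet]
    simp [iterInt, this, Measure.real, volume_pi]

theorem cont_prod (a : ℝ → A) (ha : Continuous a) (n : ℕ) :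
    Continuous fun t : Fin n → ℝ => (List.ofFn fun i : Fin n => a (t i)).prod := by
  induction n with
  | zero => simpa using continuous_const
  | succ n ih =>
    simp only [List.ofFn_succ, List.prod_cons]
    exact (ha.comp (continuous_apply 0)).mul
      (ih.comp (continuous_pi fun i => continuous_apply i.succ))

theorem int_prod (a : ℝ → A) (ha : Continuous a) (n : ℕ) (b c : ℝ) :
    IntegrableOn (fun t : Fin n → ℝ => (List.ofFn fun i : Fin n => a (t i)).prod)
      (ordSet n b c) :=
  (cont_prod a ha n).continuousOn.integrableOn_compact (isCompact_ordSet n b c)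

theorem iterInt_succ' (a : ℝ → A) (ha : Continuous a) (n : ℕ) (b c : ℝ) (hbc : b ≤ c) :
    iterInt a (n+1) c b = ∫ t in b..c, a t * iterInt a n t b := by
  have hm := fun n b c => (isCompact_ordSet n b c).measurableSet
  have mp := (volume_preserving_piFinSuccAbove (fun _ : Fin (n+1) => ℝ) 0).symm
  have hint := (int_prod a ha (n+1) b c)
  rw [← integrable_indicator_iff (hm _ _ _), ← mp.integrable_comp_emb
    (MeasurableEquiv.measurableEmbedding _)] at hint
  rw [intervalIntegral.integral_of_le hbc, ← integral_Icc_eq_integral_Ioc,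
    ← integral_indicator measurableSet_Icc, iterInt, ← integral_indicator (hm _ _ _),
    ← mp.integral_comp (MeasurableEquiv.measurableEmbedding _)]
  rw [Measure.volume_eq_prod] at hint ⊢
  refine (integral_prod _ hint).trans ?_
  congr 1
  ext x
  have key : ∀ y : Fin n → ℝ, (MeasurableEquiv.piFinSuccAbove (fun _ : Fin (n+1) => ℝ) 0).symm (x, y)
      = (Fin.cons x y : Fin (n+1) → ℝ) := by
    intro y
    simp [MeasurableEquiv.piFinSuccAbove, Fin.insertNthEquiv]
  change (∫ y : Fin n → ℝ, (ordSet (n+1) b c).indicator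
        (fun t : Fin (n+1) → ℝ => (List.ofFn fun i : Fin (n+1) => a (t i)).prod)
        ((MeasurableEquiv.piFinSuccAbove (fun _ : Fin (n+1) => ℝ) 0).symm (x, y))) = _
  simp_rw [key]
  by_cases hx : x ∈ Icc b c
  · rw [indicator_of_mem hx, iterInt_eq]
    rw [← integral_const_mul_of_integrable (int_prod a ha n b x), ← integral_indicator (hm _ _ _)]
    congr 1
    ext y
    by_cases hy : y ∈ ordSet n b x
    · rw [indicator_of_mem hy, indicator_of_mem ((ordSet_cons n b c x y).2 ⟨hx, hy⟩)]
      simp [List.ofFn_succ]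
    · rw [indicator_of_notMem hy, indicator_of_notMem
        (fun h => hy ((ordSet_cons n b c x y).1 h).2)]
  · rw [indicator_of_notMem hx]
    have : ∀ y, (ordSet (n+1) b c).indicator
        (fun t : Fin (n+1) → ℝ => (List.ofFn fun i : Fin (n+1) => a (t i)).prod)
        (Fin.cons x y) = 0 := fun y =>
      indicator_of_notMem (fun h => hx ((ordSet_cons n b c x y).1 h).1) _
    simp only [this, integral_zero]

theorem cont_iterInt (a : ℝ → A) (ha : Continuous a) (n : ℕ) (b : ℝ) :
    ContinuousOn (fun c => iterInt a n c b) (Ici b) := by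
  induction n with
  | zero => exact continuousOn_const
  | succ n ih =>
    have h1 : Continuous (fun t => a t * iterInt a n (max b t) b) :=
      ha.mul (ih.comp_continuous (by fun_prop) (fun t => mem_Ici.2 (le_max_left _ _)))
    have h2 : Continuous fun c => ∫ t in b..c, a t * iterInt a n (max b t) b :=
      intervalIntegral.continuous_primitive (fun _ _ => h1.intervalIntegrable _ _) b
    refine h2.continuousOn.congr fun c hc => ?_
    simp only
    rw [iterInt_succ' a ha n b c hc]
    refine intervalIntegral.integral_congr fun t ht => ?_
    rw [uIcc_of_le hc] at ht
    simp [max_eq_right ht.1]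

theorem fact_cont (a : ℝ → A) (ha : Continuous a) (b s : ℝ) (hbs : b ≤ s) (n : ℕ) :
    ∀ c, s ≤ c → iterInt a n c b =
      ∑ l ∈ Finset.range (n + 1), iterInt a l c s * iterInt a (n - l) s b := by
  induction n with
  | zero => intro c _; simp [iterInt]
  | succ n ih =>
    intro c hsc
    have hI : ∀ m b u v, b ≤ u → u ≤ v →
        IntervalIntegrable (fun t => a t * iterInt a m t b) volume u v := by
      intro m b u v hu huv
      refine ContinuousOn.intervalIntegrable (ha.continuousOn.mul
        ((cont_iterInt a ha m b).mono ?_))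
      rw [uIcc_of_le huv]
      exact fun t ht => hu.trans ht.1
    rw [iterInt_succ' a ha n b c (hbs.trans hsc), Finset.sum_range_succ',
      ← intervalIntegral.integral_add_adjacent_intervals (hI n b b s le_rfl hbs)
        (hI n b s c hbs hsc), ← iterInt_succ' a ha n b s hbs, add_comm]
    congr 1
    · have : ∫ t in s..c, a t * iterInt a n t b = ∫ t in s..c,
          ∑ l ∈ Finset.range (n + 1), (a t * iterInt a l t s) * iterInt a (n - l) s b := by
        refine intervalIntegral.integral_congr fun t ht => ?_
        rw [uIcc_of_le hsc] at ht
        rw [ih t ht.1, Finset.mul_sum]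
        simp only [mul_assoc]
      rw [this, intervalIntegral.integral_finsetSum]
      · refine Finset.sum_congr rfl fun l _ => ?_
        rw [iterInt_succ' a ha l s c hsc, Nat.add_sub_add_right,
          intervalIntegral.integral_of_le hsc, intervalIntegral.integral_of_le hsc]
        exact integral_mul_const_of_integrable ((hI l s s c le_rfl hsc).1)
      · intro l _
        exact (hI l s s c le_rfl hsc).mul_const _
    · simp [iterInt]

theorem iterInt_congr (a a' : ℝ → A) (n : ℕ) (b c : ℝ) (h : ∀ t ∈ Icc b c, a t = a' t) :
    iterInt a n c b = iterInt a' n c b := by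
  rw [iterInt_eq, iterInt_eq]
  refine setIntegral_congr_fun (isCompact_ordSet n b c).measurableSet fun t ht => ?_
  congr 2
  ext i
  exact h _ (ht.1 i)
end

/-- Factorization of iterated integrals under subdivision of the interval at `s ∈ [0,1]`:
`J_n(1,0) = Σ_{l=0}^{n} J_l(1,s)·J_{n−l}(s,0)` for every `n ≥ 1`. -/
theorem stmt9 {A : Type*} [NormedRing A] [NormedAlgebra ℝ A] [CompleteSpace A]
    (a : ℝ → A) (ha : ContinuousOn a (Set.Icc 0 1))
    (s : ℝ) (hs : s ∈ Set.Icc (0 : ℝ) 1) (n : ℕ) (hn : 1 ≤ n) :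
    iterInt a n 1 0 = ∑ l ∈ Finset.range (n + 1), iterInt a l 1 s * iterInt a (n - l) s 0 := by
  have hc : Continuous (fun t : ℝ => a (max 0 (min 1 t))) :=
    ha.comp_continuous (by fun_prop) fun t => by simp
  have he : ∀ t ∈ Icc (0:ℝ) 1, a t = a (max 0 (min 1 t)) := fun t ht => by
    rw [min_eq_right ht.2, max_eq_right ht.1]
  have h := fact_cont _ hc 0 s hs.1 n 1 hs.2
  rw [iterInt_congr a _ n 0 1 he, h]
  refine Finset.sum_congr rfl fun l _ => ?_
  rw [iterInt_congr a _ l s 1 fun t ht => he t ⟨hs.1.trans ht.1, ht.2⟩,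
    iterInt_congr a _ (n - l) 0 s fun t ht => he t ⟨ht.1, ht.2.trans hs.2⟩]
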